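/- Let n, m be positive integers, let k = (k₁,…,kₙ) be a weight vector, let Θ ∈ Bad(k,n,m), and let C ⊂ ℝⁿ be an everywhere non-degenerate C¹ curve. Then the Hausdorff dimension of the set Bad_Θ(k,n,m) ∩ C equals 1. -/

import Mathlib

open Real MeasureTheory Topology

/-- Distance from a real number to the nearest integer. -/
noncomputable def distNearestInt (y : ℝ) : ℝ := ⨅ p : ℤ, |y - (p : ℝ)|

/-- `Θᵢ(q) = ∑ⱼ qⱼ Θᵢⱼ` : the `i`-th linear form of `Θ` evaluated at `q ∈ ℤᵐ`. -/
noncomputable def linForm {n m : ℕ} (Θ : Matrix (Fin n) (Fin m) ℝ) (q : Fin m → ℤ)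
    (i : Fin n) : ℝ := ∑ j, (q j : ℝ) * Θ i j

/-- `Θ*ⱼ(u) = ∑ᵢ uᵢ Θᵢⱼ` : the `j`-th linear form of the transposed matrix `Θ*`. -/
noncomputable def dualForm {n m : ℕ} (Θ : Matrix (Fin n) (Fin m) ℝ) (u : Fin n → ℤ)
    (j : Fin m) : ℝ := ∑ i, (u i : ℝ) * Θ i j

/-- The supremum norm `|q|` of an integer vector. -/
noncomputable def supNorm {m : ℕ} (q : Fin m → ℤ) : ℝ := ⨆ j, |(q j : ℝ)|

/-- A weight vector: positive entries summing to 1. -/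
def IsWeight {n : ℕ} (k : Fin n → ℝ) : Prop := (∀ i, 0 < k i) ∧ ∑ i, k i = 1

/-- The set `Bad(k,n,m)` of weighted badly approximable `n × m` matrices:
`inf_{q ∈ ℤᵐ, q ≠ 0} max_{1≤i≤n} |q|^{m kᵢ} ‖Θᵢ(q)‖ > 0`. -/
def Bad (n m : ℕ) (k : Fin n → ℝ) : Set (Matrix (Fin n) (Fin m) ℝ) :=
  {Θ | ∃ c > 0, ∀ q : Fin m → ℤ, q ≠ 0 →
    c ≤ ⨆ i, supNorm q ^ ((m : ℝ) * k i) * distNearestInt (linForm Θ q i)}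

/-- The twisted set `Bad_Θ(k,n,m)`:
`{x ∈ ℝⁿ : inf_{q ∈ ℤᵐ, q ≠ 0} max_{1≤i≤n} |q|^{m kᵢ} ‖Θᵢ(q) − xᵢ‖ > 0}`. -/
def BadT (n m : ℕ) (k : Fin n → ℝ) (Θ : Matrix (Fin n) (Fin m) ℝ) : Set (Fin n → ℝ) :=
  {x | ∃ c > 0, ∀ q : Fin m → ℤ, q ≠ 0 →
    c ≤ ⨆ i, supNorm q ^ ((m : ℝ) * k i) * distNearestInt (linForm Θ q i - x i)}

open scoped NNReal ENNReal

theorem le_dimH_range_of_digits {X : Type*} [MetricSpace X] {M : ℕ} (hM : 1 < M) {s : ℝ≥0}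
    (hs : 0 < s) {C : ℝ≥0} (z : (ℕ → Fin M) → X)
    (hz : ∀ (d e : ℕ → Fin M) (t : ℕ), (∀ i < t, d i = e i) → d t ≠ e t →
      ((M : ℝ) ^ t)⁻¹ ≤ C * dist (z d) (z e) ^ (s : ℝ)) :
    (s : ℝ≥0∞) ≤ dimH (Set.range z) := by
  have hM0 : 0 < M := by omega
  have first_diff : ∀ d e : ℕ → Fin M, d ≠ e → ∃ t, (∀ i < t, d i = e i) ∧ d t ≠ e t := by
    intro d e hde
    have h : ∃ t, d t ≠ e t := by
      by_contra! h
      exact hde (funext h)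
    classical
    exact ⟨Nat.find h, fun i hi => not_not.1 (Nat.find_min h hi), Nat.find_spec h⟩
  have hinj : Function.Injective z := by
    intro d e hde
    by_contra hne
    obtain ⟨t, h1, h2⟩ := first_diff d e hne
    have h := hz d e t h1 h2
    rw [hde, dist_self, Real.zero_rpow (by exact_mod_cast hs.ne'), mul_zero] at h
    have : 0 < ((M : ℝ) ^ t)⁻¹ := by positivity
    linarith
  have : Nonempty (ℕ → Fin M) := ⟨fun _ => ⟨0, hM0⟩⟩
  set g : X → ℝ := fun x => Real.ofDigits (Function.invFun z x) with hg
  have hgz : ∀ d, g (z d) = Real.ofDigits d := fun d => by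
    simp only [hg, Function.leftInverse_invFun hinj d]
  have hhol : HolderOnWith C s g (Set.range z) := by
    rintro _ ⟨d, rfl⟩ _ ⟨e, rfl⟩
    rw [hgz, hgz, edist_dist, edist_dist (z d),
      ENNReal.ofReal_rpow_of_nonneg dist_nonneg s.coe_nonneg, ← ENNReal.ofReal_coe_nnreal, ← ENNReal.ofReal_mul C.coe_nonneg]
    apply ENNReal.ofReal_le_ofReal
    by_cases hde : d = e
    · subst hde
      rw [dist_self]
      positivity
    obtain ⟨t, h1, h2⟩ := first_diff d e hde
    exact (Real.abs_ofDigits_sub_ofDigits_le h1).trans (hz d e t h1 h2)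
  have himg : Set.Icc (0 : ℝ) 1 ⊆ g '' Set.range z := by
    intro y hy
    obtain ⟨d, -, rfl⟩ := Real.ofDigits_SurjOn hM hy
    exact ⟨z d, ⟨d, rfl⟩, hgz d⟩
  have h1 : dimH (Set.Icc (0 : ℝ) 1) = 1 := by
    have := Real.dimH_of_nonempty_interior (E := ℝ) (s := Set.Icc (0 : ℝ) 1) (by simp)
    simpa using this
  have h2 : 1 ≤ dimH (Set.range z) / s :=
    h1 ▸ (dimH_mono himg).trans (hhol.dimH_image_le hs)
  rw [ENNReal.le_div_iff_mul_le (by simp [hs.ne']) (by simp)] at h2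
  simpa using h2

theorem le_dimH_avoiding {M : ℕ} (hM : 1 < M) {s : ℝ≥0} (hs : 0 < s)
    (hMs : (2 * M + 1 : ℝ) ^ (s : ℝ) ≤ M) {x₀ l : ℝ} (hl : 0 < l) (B : ℕ → Set ℝ)
    (hB : ∀ t, ∀ x ∈ B t, ∀ y ∈ B t, |x - y| ≤ l / (2 * M + 1) ^ t →
      |x - y| < l / (2 * M + 1) ^ (t + 1)) :
    (s : ℝ≥0∞) ≤ dimH {x ∈ Set.Icc x₀ (x₀ + l) | ∀ t, x ∉ B t} := by
  set N : ℝ := 2 * M + 1 with hN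
  have hN0 : 0 < N := by positivity
  set w : ℕ → ℝ := fun t => l / N ^ t with hw
  have hw0 : ∀ t, 0 < w t := fun t => by positivity
  have hws : ∀ t, w t = N * w (t + 1) := fun t => by
    simp only [hw, pow_succ]; field_simp
  have hskip : ∀ (t : ℕ) (y : ℝ), ∃ p : Fin (M + 1), ∀ j, j ≠ p →
      ∀ x ∈ Set.Icc (y + 2 * (j : ℕ) * w (t + 1)) (y + 2 * (j : ℕ) * w (t + 1) + w (t + 1)),
        x ∉ B t := by
    intro t y
    by_cases h : ∃ p : Fin (M + 1), ∃ x ∈ Set.Icc (y + 2 * (p : ℕ) * w (t + 1))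
        (y + 2 * (p : ℕ) * w (t + 1) + w (t + 1)), x ∈ B t
    · obtain ⟨p, u, hu, huB⟩ := h
      refine ⟨p, fun j hj x hx hxB => ?_⟩
      have hpos := hw0 (t + 1)
      have hub : ∀ i : Fin (M + 1), 2 * ((i : ℕ) : ℝ) * w (t + 1) + w (t + 1) ≤ w t := by
        intro i
        have : ((i : ℕ) : ℝ) ≤ M := by exact_mod_cast Nat.lt_succ_iff.1 i.2
        rw [hws t, hN]
        nlinarith
      have hnn : ∀ i : Fin (M + 1), 0 ≤ 2 * ((i : ℕ) : ℝ) * w (t + 1) := fun i => by positivity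
      have hlt := hB t x hxB u huB (abs_le.2 ⟨by
        linarith [hx.1, hx.2, hu.1, hu.2, hub j, hub p, hnn j, hnn p], by
        linarith [hx.1, hx.2, hu.1, hu.2, hub j, hub p, hnn j, hnn p]⟩)
      change |x - u| < w (t + 1) at hlt
      rw [abs_lt] at hlt
      rcases lt_or_gt_of_ne (fun h => hj (Fin.ext h) : (j : ℕ) ≠ p) with h | h
      · have : ((j : ℕ) : ℝ) + 1 ≤ (p : ℕ) := by exact_mod_cast h
        nlinarith [hx.1, hx.2, hu.1, hu.2]
      · have : ((p : ℕ) : ℝ) + 1 ≤ (j : ℕ) := by exact_mod_cast h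
        nlinarith [hx.1, hx.2, hu.1, hu.2]
    · push Not at h
      exact ⟨0, fun j _ x hx => h j x hx⟩
  choose p hp using hskip
  let E : (ℕ → Fin M) → ℕ → ℝ := fun d t => Nat.rec x₀
    (fun t y => y + 2 * (((p t y).succAbove (d t) : Fin (M + 1)) : ℕ) * w (t + 1)) t
  have hE0 : ∀ d, E d 0 = x₀ := fun d => rfl
  have hEs : ∀ d t, E d (t + 1) =
      E d t + 2 * (((p t (E d t)).succAbove (d t) : Fin (M + 1)) : ℕ) * w (t + 1) :=
    fun d t => rfl
  have hmono : ∀ d, Monotone (E d) := fun d => monotone_nat_of_le_succ fun t => by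
    rw [hEs]
    have := (hw0 (t + 1)).le
    exact le_add_of_nonneg_right (by positivity)
  have hanti : ∀ d, Antitone fun t => E d t + w t := fun d => antitone_nat_of_succ_le fun t => by
    rw [hEs, hws t, hN]
    have h1 := hw0 (t + 1)
    have h2 : ((((p t (E d t)).succAbove (d t) : Fin (M + 1)) : ℕ) : ℝ) ≤ M := by
      exact_mod_cast Nat.lt_succ_iff.1 (Fin.is_lt _)
    nlinarith
  have hmem : ∀ d t, (⨆ t, E d t) ∈ Set.Icc (E d t) (E d t + w t) := fun d =>
    Set.mem_iInter.1 ((hmono d).ciSup_mem_iInter_Icc_of_antitone (hanti d)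
      fun t => le_add_of_nonneg_right (hw0 t).le)
  have hEcongr : ∀ (d e : ℕ → Fin M) (t : ℕ), (∀ i < t, d i = e i) → E d t = E e t := by
    intro d e t
    induction t with
    | zero => intro _; rfl
    | succ t ih =>
      intro h
      rw [hEs, hEs, ih fun i hi => h i (by omega), h t (by omega)]
  have hsep : ∀ (d e : ℕ → Fin M) (t : ℕ), (∀ i < t, d i = e i) → d t ≠ e t →
      w (t + 1) ≤ dist (⨆ t, E d t) (⨆ t, E e t) := by
    intro d e t h hne
    have h1 := hmem d (t + 1)
    have h2 := hmem e (t + 1)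
    rw [hEs] at h1 h2
    rw [← hEcongr d e t h] at h2
    have hne' : (((p t (E d t)).succAbove (d t) : Fin (M + 1)) : ℕ) ≠
        (((p t (E d t)).succAbove (e t) : Fin (M + 1)) : ℕ) := fun h =>
      hne (Fin.succAbove_right_injective (Fin.ext h))
    have hpos := hw0 (t + 1)
    rw [Real.dist_eq]
    rcases lt_or_gt_of_ne hne' with h | h
    · have : ((((p t (E d t)).succAbove (d t) : Fin (M + 1)) : ℕ) : ℝ) + 1 ≤
        (((p t (E d t)).succAbove (e t) : Fin (M + 1)) : ℕ) := by exact_mod_cast h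
      rw [abs_sub_comm]
      refine le_trans ?_ (le_abs_self _)
      nlinarith [h1.1, h1.2, h2.1, h2.2]
    · have : ((((p t (E d t)).succAbove (e t) : Fin (M + 1)) : ℕ) : ℝ) + 1 ≤
        (((p t (E d t)).succAbove (d t) : Fin (M + 1)) : ℕ) := by exact_mod_cast h
      refine le_trans ?_ (le_abs_self _)
      nlinarith [h1.1, h1.2, h2.1, h2.2]
  have hMpos : (0 : ℝ) < M := by positivity
  refine (le_dimH_range_of_digits hM hs (C := ⟨(N / l) ^ (s : ℝ), by positivity⟩)
    (fun d => ⨆ t, E d t) fun d e t h hne => ?_).trans (dimH_mono ?_)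
  · calc ((M : ℝ) ^ t)⁻¹ ≤ ((N ^ (s : ℝ)) ^ t)⁻¹ := by gcongr
      _ = (N / l * w (t + 1)) ^ (s : ℝ) := by
        have : N / l * w (t + 1) = (N ^ t)⁻¹ := by
          simp only [hw, pow_succ]; field_simp
        rw [this, Real.inv_rpow (by positivity), ← Real.rpow_natCast, ← Real.rpow_natCast,
          ← Real.rpow_mul hN0.le, ← Real.rpow_mul hN0.le, mul_comm (s : ℝ)]
      _ = (N / l) ^ (s : ℝ) * w (t + 1) ^ (s : ℝ) :=
        Real.mul_rpow (by positivity) (hw0 _).le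
      _ ≤ (N / l) ^ (s : ℝ) * dist (⨆ t, E d t) (⨆ t, E e t) ^ (s : ℝ) := by
        have := (hw0 (t + 1)).le
        gcongr
        exact hsep d e t h hne
  · rintro _ ⟨d, rfl⟩
    refine ⟨?_, fun t => ?_⟩
    · have := hmem d 0
      rwa [hE0, show w 0 = l by simp [hw]] at this
    · have := hmem d (t + 1)
      rw [hEs] at this
      exact hp t (E d t) _ (Fin.succAbove_ne _ _) _ this

theorem exists_rpow_le_natCast {s : ℝ≥0} (hs : s < 1) :
    ∃ M : ℕ, 1 < M ∧ (2 * M + 1 : ℝ) ^ (s : ℝ) ≤ M := by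
  have h1 : (0 : ℝ) < 1 - s := sub_pos.2 (by exact_mod_cast hs)
  have h2 := (tendsto_rpow_atTop h1).comp (tendsto_natCast_atTop_atTop (R := ℝ))
  obtain ⟨M, hM, hM1⟩ := ((h2.eventually_ge_atTop ((3 : ℝ) ^ (s : ℝ))).and
    (Filter.eventually_gt_atTop 1)).exists
  refine ⟨M, hM1, ?_⟩
  have hM1' : (1 : ℝ) < M := by exact_mod_cast hM1
  simp only [Function.comp] at hM
  calc (2 * M + 1 : ℝ) ^ (s : ℝ) ≤ (3 * M) ^ (s : ℝ) := by gcongr; linarith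
    _ = 3 ^ (s : ℝ) * (M : ℝ) ^ (s : ℝ) := Real.mul_rpow (by positivity) (by positivity)
    _ ≤ (M : ℝ) ^ (1 - s : ℝ) * (M : ℝ) ^ (s : ℝ) := by gcongr
    _ = M := by rw [← Real.rpow_add (by positivity)]; simp

theorem distNearestInt_eq_norm (y : ℝ) : distNearestInt y = ‖(y : UnitAddCircle)‖ := by
  rw [UnitAddCircle.norm_eq]
  exact le_antisymm (ciInf_le ⟨0, by rintro _ ⟨p, rfl⟩; positivity⟩ (round y))
    (le_ciInf (round_le y))

theorem distNearestInt_nonneg (y : ℝ) : 0 ≤ distNearestInt y := by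
  rw [distNearestInt_eq_norm]; positivity

theorem distNearestInt_le_abs (y : ℝ) : distNearestInt y ≤ |y| := by
  rw [distNearestInt_eq_norm, UnitAddCircle.norm_eq]
  simpa using round_le y 0

theorem distNearestInt_eq_abs {y : ℝ} (hy : |y| ≤ 1 / 2) : distNearestInt y = |y| := by
  rw [distNearestInt_eq_norm]
  exact (AddCircle.norm_coe_eq_abs_iff (1 : ℝ) one_ne_zero).2 (by simpa using hy)

theorem distNearestInt_add_le (x y : ℝ) :
    distNearestInt (x + y) ≤ distNearestInt x + distNearestInt y := by
  simp only [distNearestInt_eq_norm, AddCircle.coe_add]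
  exact norm_add_le _ _

theorem distNearestInt_neg (y : ℝ) : distNearestInt (-y) = distNearestInt y := by
  simp only [distNearestInt_eq_norm, AddCircle.coe_neg, norm_neg]

theorem abs_le_supNorm {m : ℕ} (q : Fin m → ℤ) (j : Fin m) : |(q j : ℝ)| ≤ supNorm q :=
  le_ciSup (f := fun j => |(q j : ℝ)|) (Set.finite_range _).bddAbove j

theorem supNorm_nonneg {m : ℕ} (q : Fin m → ℤ) : 0 ≤ supNorm q :=
  Real.iSup_nonneg fun _ => abs_nonneg _

theorem supNorm_sub_le {m : ℕ} (q r : Fin m → ℤ) : supNorm (q - r) ≤ supNorm q + supNorm r := by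
  refine Real.iSup_le (fun j => ?_) (add_nonneg (supNorm_nonneg q) (supNorm_nonneg r))
  rw [Pi.sub_apply, Int.cast_sub]
  exact (abs_sub _ _).trans (add_le_add (abs_le_supNorm q j) (abs_le_supNorm r j))

theorem one_le_supNorm {m : ℕ} {q : Fin m → ℤ} (hq : q ≠ 0) : 1 ≤ supNorm q := by
  obtain ⟨j, hj⟩ := Function.ne_iff.1 hq
  refine le_trans ?_ (abs_le_supNorm q j)
  exact_mod_cast Int.one_le_abs hj

theorem linForm_sub {n m : ℕ} (Θ : Matrix (Fin n) (Fin m) ℝ) (q r : Fin m → ℤ) (i : Fin n) :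
    linForm Θ (q - r) i = linForm Θ q i - linForm Θ r i := by
  simp [linForm, sub_mul, Finset.sum_sub_distrib]

theorem IsWeight.le_one {n : ℕ} {k : Fin n → ℝ} (hk : IsWeight k) (i : Fin n) : k i ≤ 1 :=
  hk.2 ▸ Finset.single_le_sum (fun j _ => (hk.1 j).le) (Finset.mem_univ i)

theorem linForm_separated {n m : ℕ} (hn : 0 < n) {k : Fin n → ℝ} (hk : IsWeight k)
    {Θ : Matrix (Fin n) (Fin m) ℝ} {c : ℝ}
    (hc : ∀ q : Fin m → ℤ, q ≠ 0 →
      c ≤ ⨆ i, supNorm q ^ ((m : ℝ) * k i) * distNearestInt (linForm Θ q i))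
    {R T β : ℝ} (hR : 1 ≤ R) (hT : 0 < T) {q r : Fin m → ℤ} (hqr : q ≠ r)
    (hq : supNorm q ≤ R * T) (hr : supNorm r ≤ R * T)
    (hβ : ∀ i, T ^ ((m : ℝ) * k i) * distNearestInt (linForm Θ q i - linForm Θ r i) ≤ β) :
    c ≤ (2 * R) ^ m * β := by
  have : Nonempty (Fin n) := ⟨⟨0, hn⟩⟩
  refine (hc (q - r) (sub_ne_zero.2 hqr)).trans (ciSup_le fun i => ?_)
  have hk0 := (hk.1 i).le
  have hd := distNearestInt_nonneg (linForm Θ q i - linForm Θ r i)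
  have hS : supNorm (q - r) ≤ 2 * R * T := by linarith [supNorm_sub_le q r]
  rw [linForm_sub]
  calc supNorm (q - r) ^ ((m : ℝ) * k i) * distNearestInt (linForm Θ q i - linForm Θ r i)
      ≤ (2 * R * T) ^ ((m : ℝ) * k i) * distNearestInt (linForm Θ q i - linForm Θ r i) := by
        have := supNorm_nonneg (q - r)
        gcongr
    _ = (2 * R) ^ ((m : ℝ) * k i) *
        (T ^ ((m : ℝ) * k i) * distNearestInt (linForm Θ q i - linForm Θ r i)) := by
        rw [Real.mul_rpow (by positivity) hT.le, mul_assoc]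
    _ ≤ (2 * R) ^ (m : ℝ) *
        (T ^ ((m : ℝ) * k i) * distNearestInt (linForm Θ q i - linForm Θ r i)) := by
        gcongr
        · linarith
        · exact mul_le_of_le_one_right (by positivity) (hk.le_one i)
    _ ≤ (2 * R) ^ m * β := by
        rw [Real.rpow_natCast]
        gcongr
        exact hβ i

theorem exists_mul_abs_sub_le_of_deriv_ne_zero {a b : ℝ} {g g' : ℝ → ℝ}
    (hderiv : ∀ x ∈ Set.Icc a b, HasDerivWithinAt g (g' x) (Set.Icc a b) x)
    (hcont : ContinuousOn g' (Set.Icc a b)) (hnd : ∀ x ∈ Set.Icc a b, g' x ≠ 0) :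
    ∃ κ > 0, ∀ x ∈ Set.Icc a b, ∀ y ∈ Set.Icc a b, κ * |x - y| ≤ |g x - g y| := by
  obtain ⟨κ, hκ, hle⟩ : ∃ κ > 0, ∀ x ∈ Set.Icc a b, κ ≤ |g' x| :=
    isCompact_Icc.exists_forall_le' hcont.abs fun x hx => abs_pos.2 (hnd x hx)
  have key : ∀ x ∈ Set.Icc a b, ∀ y ∈ Set.Icc a b, x < y → κ * |x - y| ≤ |g x - g y| := by
    intro x hx y hy hxy
    have hsub : Set.Icc x y ⊆ Set.Icc a b := Set.Icc_subset_Icc hx.1 hy.2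
    obtain ⟨ξ, hξ, h⟩ := exists_hasDerivAt_eq_slope g g' hxy
      (fun u hu => ((hderiv u (hsub hu)).continuousWithinAt).mono hsub)
      (fun u hu => (hderiv u (hsub (Set.Ioo_subset_Icc_self hu))).hasDerivAt
        (Icc_mem_nhds (hx.1.trans_lt hu.1) (hu.2.trans_le hy.2)))
    have hξ' := hle ξ (hsub (Set.Ioo_subset_Icc_self hξ))
    rw [h, abs_div, le_div_iff₀ (abs_pos.2 (sub_pos.2 hxy).ne')] at hξ'
    rwa [abs_sub_comm x, abs_sub_comm (g x)]
  refine ⟨κ, hκ, fun x hx y hy => ?_⟩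
  rcases lt_trichotomy x y with h | rfl | h
  · exact key x hx y hy h
  · simp
  · rw [abs_sub_comm x, abs_sub_comm (g x)]
    exact key y hy x hx h

/-- Parameters `x` in `[a, b]` for which some `q` with `T ≤ |q| ≤ R T` puts `Θ(q)` too close
to `f x` modulo `ℤⁿ`. -/
def closeParams {n m : ℕ} (k : Fin n → ℝ) (Θ : Matrix (Fin n) (Fin m) ℝ) (f : ℝ → Fin n → ℝ)
    (a b ε R T : ℝ) : Set ℝ :=
  {x ∈ Set.Icc a b | ∃ q : Fin m → ℤ, T ≤ supNorm q ∧ supNorm q ≤ R * T ∧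
    ∀ i, supNorm q ^ ((m : ℝ) * k i) * distNearestInt (linForm Θ q i - f x i) < ε}

theorem mem_BadT_of_notMem_closeParams {n m : ℕ} {k : Fin n → ℝ}
    {Θ : Matrix (Fin n) (Fin m) ℝ} {f : ℝ → Fin n → ℝ} {a b ε R : ℝ} (hε : 0 < ε) (hR : 1 < R)
    {x : ℝ} (hx : x ∈ Set.Icc a b) (h : ∀ t : ℕ, x ∉ closeParams k Θ f a b ε R (R ^ t)) :
    f x ∈ BadT n m k Θ := by
  refine ⟨ε, hε, fun q hq => ?_⟩
  obtain ⟨t, ht1, ht2⟩ := exists_nat_pow_near (one_le_supNorm hq) hR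
  by_contra! hlt
  refine h t ⟨hx, q, ht1, by rw [pow_succ'] at ht2; exact ht2.le, fun i => lt_of_le_of_lt ?_ hlt⟩
  exact le_ciSup
    (f := fun i => supNorm q ^ ((m : ℝ) * k i) * distNearestInt (linForm Θ q i - f x i))
    (Set.finite_range _).bddAbove i

theorem abs_sub_le_of_mem_closeParams {n m : ℕ} (hn : 0 < n)
    {k : Fin n → ℝ} (hk : IsWeight k) {Θ : Matrix (Fin n) (Fin m) ℝ} {c : ℝ}
    (hc : ∀ q : Fin m → ℤ, q ≠ 0 →
      c ≤ ⨆ i, supNorm q ^ ((m : ℝ) * k i) * distNearestInt (linForm Θ q i))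
    {f : ℝ → Fin n → ℝ} {a b ε R T L l κ : ℝ}
    (hL : ∀ x ∈ Set.Icc a b, ∀ y ∈ Set.Icc a b, ∀ i, |f x i - f y i| ≤ L * |x - y|)
    {i₀ : Fin n} (hi₀ : ∀ i, k i ≤ k i₀)
    (hκ : ∀ x ∈ Set.Icc a b, ∀ y ∈ Set.Icc a b, κ * |x - y| ≤ |f x i₀ - f y i₀|)
    (hL0 : 0 ≤ L) (hR : 1 ≤ R) (hT : 1 ≤ T) (hl : 0 ≤ l) (hLl : L * l ≤ 1 / 2)
    (hsmall : (2 * R) ^ m * (2 * ε + L * l) < c)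
    {x y : ℝ} (hx : x ∈ closeParams k Θ f a b ε R T) (hy : y ∈ closeParams k Θ f a b ε R T)
    (hxy : |x - y| ≤ l / T ^ ((m : ℝ) * k i₀)) :
    κ * |x - y| ≤ 2 * ε / T ^ ((m : ℝ) * k i₀) := by
  obtain ⟨hxI, q, hq1, hq2, hq⟩ := hx
  obtain ⟨hyI, r, hr1, hr2, hr⟩ := hy
  have hT0 : 0 < T := by linarith
  have hclose : ∀ (p : Fin m → ℤ) (z : ℝ), T ≤ supNorm p →
      (∀ i, supNorm p ^ ((m : ℝ) * k i) * distNearestInt (linForm Θ p i - f z i) < ε) →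
      ∀ i, T ^ ((m : ℝ) * k i) * distNearestInt (linForm Θ p i - f z i) ≤ ε := by
    intro p z hp h i
    refine le_trans ?_ (h i).le
    have := distNearestInt_nonneg (linForm Θ p i - f z i)
    have := (hk.1 i).le
    gcongr
  have hq' := hclose q x hq1 hq
  have hr' := hclose r y hr1 hr
  have hqr : q = r := by
    by_contra hne
    refine hsmall.not_ge (linForm_separated hn hk hc hR hT0 hne hq2 hr2 fun i => ?_)
    have htri : distNearestInt (linForm Θ q i - linForm Θ r i) ≤
        distNearestInt (linForm Θ q i - f x i) + distNearestInt (linForm Θ r i - f y i) +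
          |f x i - f y i| := by
      have h1 := distNearestInt_add_le (linForm Θ q i - f x i + -(linForm Θ r i - f y i))
        (f x i - f y i)
      have h2 := distNearestInt_add_le (linForm Θ q i - f x i) (-(linForm Θ r i - f y i))
      rw [distNearestInt_neg] at h2
      have h3 := distNearestInt_le_abs (f x i - f y i)
      rw [show linForm Θ q i - f x i + -(linForm Θ r i - f y i) + (f x i - f y i) =
        linForm Θ q i - linForm Θ r i by ring] at h1
      linarith
    have hf : T ^ ((m : ℝ) * k i) * |f x i - f y i| ≤ L * l := by
      calc T ^ ((m : ℝ) * k i) * |f x i - f y i|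
          ≤ T ^ ((m : ℝ) * k i₀) * (L * (l / T ^ ((m : ℝ) * k i₀))) := by
            have := hi₀ i
            gcongr
            exact (hL x hxI y hyI i).trans (by gcongr)
        _ = L * l := by field_simp
    have hTk : 0 ≤ T ^ ((m : ℝ) * k i) := by positivity
    have := mul_le_mul_of_nonneg_left htri hTk
    linarith [hq' i, hr' i]
  subst hqr
  have hT1 : 1 ≤ T ^ ((m : ℝ) * k i₀) :=
    Real.one_le_rpow hT (mul_nonneg (Nat.cast_nonneg m) (hk.1 i₀).le)
  have hfxy : |f x i₀ - f y i₀| ≤ 1 / 2 := by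
    refine (hL x hxI y hyI i₀).trans (le_trans ?_ hLl)
    gcongr
    exact hxy.trans (div_le_self hl hT1)
  have htri := distNearestInt_add_le (linForm Θ q i₀ - f y i₀) (-(linForm Θ q i₀ - f x i₀))
  rw [distNearestInt_neg, show linForm Θ q i₀ - f y i₀ + -(linForm Θ q i₀ - f x i₀) =
    f x i₀ - f y i₀ by ring, distNearestInt_eq_abs hfxy] at htri
  refine (hκ x hxI y hyI).trans ?_
  rw [le_div_iff₀ (by linarith)]
  have hTk : 0 ≤ T ^ ((m : ℝ) * k i₀) := by positivity
  have := mul_le_mul_of_nonneg_left htri hTk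
  linarith [hq' i₀, hr' i₀]

theorem le_dimH_setOf_mem_BadT {n m : ℕ} (hn : 0 < n) (hm : 0 < m)
    {k : Fin n → ℝ} (hk : IsWeight k) {Θ : Matrix (Fin n) (Fin m) ℝ} (hΘ : Θ ∈ Bad n m k)
    {a b : ℝ} (hab : a < b) {f : ℝ → Fin n → ℝ} {L κ : ℝ} (hL0 : 0 ≤ L) (hκ0 : 0 < κ)
    (hL : ∀ x ∈ Set.Icc a b, ∀ y ∈ Set.Icc a b, ∀ i, |f x i - f y i| ≤ L * |x - y|)
    {i₀ : Fin n} (hi₀ : ∀ i, k i ≤ k i₀)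
    (hκ : ∀ x ∈ Set.Icc a b, ∀ y ∈ Set.Icc a b, κ * |x - y| ≤ |f x i₀ - f y i₀|) :
    1 ≤ dimH {x ∈ Set.Icc a b | f x ∈ BadT n m k Θ} := by
  obtain ⟨c, hc0, hc⟩ := hΘ
  refine ENNReal.le_of_forall_nnreal_lt fun s hs => ?_
  rcases eq_or_lt_of_le (zero_le : 0 ≤ s) with rfl | hs0
  · simp
  obtain ⟨M, hM, hMs⟩ := exists_rpow_le_natCast (s := s) (by exact_mod_cast hs)
  set N : ℝ := 2 * M + 1 with hN
  have hM1 : (1 : ℝ) < M := by exact_mod_cast hM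
  have hN1 : 1 < N := by linarith
  have hN0 : 0 < N := by linarith
  have hmk : 0 < (m : ℝ) * k i₀ := mul_pos (by exact_mod_cast hm) (hk.1 i₀)
  set R : ℝ := N ^ ((m : ℝ) * k i₀)⁻¹ with hR
  have hR1 : 1 < R := Real.one_lt_rpow hN1 (by positivity)
  have hRN : ∀ t : ℕ, (R ^ t) ^ ((m : ℝ) * k i₀) = N ^ t := fun t => by
    rw [← Real.rpow_natCast, ← Real.rpow_mul (by linarith), mul_comm (t : ℝ),
      Real.rpow_mul (by linarith), hR, Real.rpow_inv_rpow hN0.le hmk.ne', Real.rpow_natCast]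
  set A : ℝ := (2 * R) ^ m with hA
  have hA0 : 0 < A := by positivity
  obtain ⟨l, hl0, hlab, hLl, hlc⟩ : ∃ l > 0, l ≤ b - a ∧ L * l ≤ 1 / 2 ∧ A * (L * l) < c / 2 := by
    have hcont : Filter.Tendsto (fun l : ℝ => L * l) (𝓝[>] 0) (𝓝 0) := by
      have : Filter.Tendsto (fun l : ℝ => L * l) (𝓝 0) (𝓝 (L * 0)) :=
        (continuous_const.mul continuous_id).tendsto 0
      rw [mul_zero] at this
      exact this.mono_left nhdsWithin_le_nhds
    have hcont' := hcont.const_mul A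
    rw [mul_zero] at hcont'
    have hpos : ∀ᶠ l : ℝ in 𝓝[>] 0, 0 < l := self_mem_nhdsWithin
    have hle : ∀ᶠ l : ℝ in 𝓝[>] 0, l ≤ b - a :=
      nhdsWithin_le_nhds (Iic_mem_nhds (sub_pos.2 hab))
    obtain ⟨l, ⟨⟨h1, h2⟩, h3⟩, h4⟩ := (((hpos.and hle).and
      (hcont.eventually_le_const (show (0 : ℝ) < 1 / 2 by norm_num))).and
      (hcont'.eventually_lt_const (half_pos hc0))).exists
    exact ⟨l, h1, h2, h3, h4⟩
  obtain ⟨ε, hε0, hεc, hεl⟩ : ∃ ε > 0, A * (2 * ε) ≤ c / 2 ∧ 2 * ε * N < κ * l := by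
    refine ⟨min (c / (4 * A)) (κ * l / (4 * N)), by positivity, ?_, ?_⟩
    · calc A * (2 * min (c / (4 * A)) (κ * l / (4 * N))) ≤ A * (2 * (c / (4 * A))) := by
            gcongr; exact min_le_left _ _
        _ = c / 2 := by field_simp; norm_num
    · calc 2 * min (c / (4 * A)) (κ * l / (4 * N)) * N ≤ 2 * (κ * l / (4 * N)) * N := by
            gcongr; exact min_le_right _ _
        _ = κ * l / 2 := by field_simp; norm_num
        _ < κ * l := half_lt_self (by positivity)
  refine (le_dimH_avoiding (x₀ := a) hM hs0 hMs hl0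
    (fun t => closeParams k Θ f a b ε R (R ^ t)) fun t x hx y hy hxy => ?_).trans
    (dimH_mono fun x hx => ?_)
  · have h := abs_sub_le_of_mem_closeParams hn hk hc hL hi₀ hκ hL0 hR1.le (one_le_pow₀ hR1.le)
      hl0.le hLl (by rw [← hA, mul_add]; linarith) hx hy (by rwa [hRN])
    rw [hRN] at h
    refine lt_of_mul_lt_mul_left (h.trans_lt ?_) hκ0.le
    calc 2 * ε / N ^ t = 2 * ε * N / N ^ (t + 1) := by rw [pow_succ]; field_simp
      _ < κ * l / N ^ (t + 1) := by gcongr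
      _ = κ * (l / N ^ (t + 1)) := by ring
  · have hxI : x ∈ Set.Icc a b := ⟨hx.1.1, by linarith [hx.1.2]⟩
    exact ⟨hxI, mem_BadT_of_notMem_closeParams hε0 hR1 hxI hx.2⟩

/-- If `Θ ∈ Bad(k,n,m)` and `C ⊂ ℝⁿ` is an everywhere non-degenerate
`C¹` curve, then `dim_H (Bad_Θ(k,n,m) ∩ C) = 1`. -/
theorem badT_inter_curve_dimH {n m : ℕ} (hn : 0 < n) (hm : 0 < m)
    (k : Fin n → ℝ) (hk : IsWeight k)
    (Θ : Matrix (Fin n) (Fin m) ℝ) (hΘ : Θ ∈ Bad n m k)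
    (a b : ℝ) (hab : a < b)
    (f f' : ℝ → Fin n → ℝ)
    (hderiv : ∀ x ∈ Set.Icc a b, HasDerivWithinAt f (f' x) (Set.Icc a b) x)
    (hcont : ContinuousOn f' (Set.Icc a b))
    (hnd : ∀ x ∈ Set.Icc a b, ∀ i, f' x i ≠ 0) :
    dimH (BadT n m k Θ ∩ f '' Set.Icc a b) = 1 := by
  have : Nonempty (Fin n) := ⟨⟨0, hn⟩⟩
  obtain ⟨i₀, hi₀⟩ := Finite.exists_max k
  obtain ⟨L, hL⟩ := isCompact_Icc.exists_bound_of_continuousOn hcont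
  have hlip : LipschitzOnWith L.toNNReal f (Set.Icc a b) :=
    (convex_Icc a b).lipschitzOnWith_of_nnnorm_hasDerivWithin_le hderiv fun x hx => by
      rw [← NNReal.coe_le_coe, coe_nnnorm]
      exact (hL x hx).trans (Real.le_coe_toNNReal L)
  obtain ⟨κ, hκ0, hκ⟩ := exists_mul_abs_sub_le_of_deriv_ne_zero
    (fun x hx => hasDerivWithinAt_pi.1 (hderiv x hx) i₀) (continuousOn_pi.1 hcont i₀)
    fun x hx => hnd x hx i₀
  apply le_antisymm
  · calc dimH (BadT n m k Θ ∩ f '' Set.Icc a b) ≤ dimH (f '' Set.Icc a b) :=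
        dimH_mono Set.inter_subset_right
      _ ≤ dimH (Set.Icc a b) := hlip.dimH_image_le
      _ ≤ dimH (Set.univ : Set ℝ) := dimH_mono (Set.subset_univ _)
      _ = 1 := Real.dimH_univ
  · set S : Set ℝ := {x ∈ Set.Icc a b | f x ∈ BadT n m k Θ} with hS
    have hdim : 1 ≤ dimH S := le_dimH_setOf_mem_BadT hn hm hk hΘ hab L.toNNReal.2 hκ0
      (fun x hx y hy i => (norm_le_pi_norm (f x - f y) i).trans (hlip.norm_sub_le hx hy)) hi₀ hκ
    have hanti : AntilipschitzWith κ.toNNReal⁻¹ (fun x : S => f x) :=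
      AntilipschitzWith.of_le_mul_dist fun x y => by
        rw [NNReal.coe_inv, Real.coe_toNNReal κ hκ0.le, inv_mul_eq_div, le_div_iff₀ hκ0, mul_comm]
        exact (hκ x x.2.1 y y.2.1).trans (norm_le_pi_norm (f x - f y) i₀)
    have h := hanti.le_dimH_image Set.univ
    have himg : (fun x : S => f x) '' Set.univ ⊆ BadT n m k Θ ∩ f '' Set.Icc a b := by
      rintro _ ⟨x, -, rfl⟩
      exact ⟨x.2.2, x, x.2.1, rfl⟩
    rw [← isometry_subtype_coe.dimH_image, Set.image_univ, Subtype.range_coe] at h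
    exact hdim.trans (h.trans (dimH_mono himg))
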